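/- arXiv:2506.03475 — 2 statements merged into one kernel-verified Lean document; each statement's English description precedes it below -/
import Mathlib

section
/- For all τ in the upper half-plane, the derivative of the weight-6 Eisenstein series satisfies Ramanujan's identity E₆'(τ) = πi(E₂(τ)E₆(τ) − E₄(τ)²). -/
open Complex Filter Asymptotics Set

noncomputable section

/-- q = e^{2πiτ} -/
def qq (τ : ℂ) : ℂ := Complex.exp (2 * (Real.pi : ℂ) * Complex.I * τ)

/-- divisor power sum σ_k(n) as a complex number -/
def sigmaC (k n : ℕ) : ℂ := ∑ d ∈ n.divisors, (d : ℂ) ^ k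

/-- normalized Eisenstein series E₂ -/
def E2 (τ : ℂ) : ℂ := 1 - 24 * ∑' n : ℕ, sigmaC 1 (n + 1) * qq τ ^ (n + 1)

/-- normalized Eisenstein series E₄ -/
def E4 (τ : ℂ) : ℂ := 1 + 240 * ∑' n : ℕ, sigmaC 3 (n + 1) * qq τ ^ (n + 1)

/-- normalized Eisenstein series E₆ -/
def E6 (τ : ℂ) : ℂ := 1 - 504 * ∑' n : ℕ, sigmaC 5 (n + 1) * qq τ ^ (n + 1)

/-- elliptic invariant g₂ -/
def g2 (τ : ℂ) : ℂ := (4 * (Real.pi : ℂ) ^ 4 / 3) * E4 τ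

/-- elliptic invariant g₃ -/
def g3 (τ : ℂ) : ℂ := (8 * (Real.pi : ℂ) ^ 6 / 27) * E6 τ

/-- quasi-period η₁ -/
def eta1 (τ : ℂ) : ℂ := ((Real.pi : ℂ) ^ 2 / 3) * E2 τ

/-- quasi-period η₂ (Legendre relation) -/
def eta2 (τ : ℂ) : ℂ := τ * eta1 τ - 2 * (Real.pi : ℂ) * Complex.I

/-- the function h = g₂² − 18η₁g₃ -/
def hh (τ : ℂ) : ℂ := g2 τ ^ 2 - 18 * eta1 τ * g3 τ

/-- the family f_C -/
def f (C τ : ℂ) : ℂ := (C - τ) * g2 τ ^ 2 - 18 * (C * eta1 τ - eta2 τ) * g3 τ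

end

section Helpers

open scoped MatrixGroups ModularForm Manifold Topology UpperHalfPlane
open UpperHalfPlane (ofComplex atImInfty upperHalfPlaneSet)

/-- The series `∑ σ_k(n) qⁿ` as a function of `q`. -/
noncomputable def sigSer (k : ℕ) (q : ℂ) : ℂ := ∑' n : ℕ, sigmaC k (n + 1) * q ^ (n + 1)

lemma sigmaC_eq (k n : ℕ) : sigmaC k n = (ArithmeticFunction.sigma k n : ℂ) := by
  simp [sigmaC, ArithmeticFunction.sigma_apply]

lemma sigSer_zero (k : ℕ) : sigSer k 0 = 0 := by
  simp [sigSer]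

lemma sigSer_differentiableOn (k : ℕ) {r : ℝ} (hr : 0 ≤ r) (hr1 : r < 1) :
    DifferentiableOn ℂ (sigSer k) (Metric.ball 0 r) := by
  unfold sigSer
  have hs : Summable fun n : ℕ => ((n : ℝ) ^ (k + 1) * r ^ n : ℝ) :=
    summable_pow_mul_geometric_of_norm_lt_one (k + 1)
      (by rwa [Real.norm_eq_abs, abs_of_nonneg hr])
  refine Complex.differentiableOn_tsum_of_summable_norm
    ((summable_nat_add_iff 1).mpr hs) (fun n => by fun_prop) Metric.isOpen_ball ?_
  intro n w hw
  have hw' : ‖w‖ ≤ r := by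
    have := mem_ball_zero_iff.mp hw
    exact this.le
  rw [sigmaC_eq, norm_mul, norm_pow, Complex.norm_natCast]
  gcongr
  exact_mod_cast ArithmeticFunction.sigma_le_pow_succ k (n + 1)

lemma sigSer_differentiableOn_ball (k : ℕ) :
    DifferentiableOn ℂ (sigSer k) (Metric.ball 0 1) := by
  intro w hw
  have hw' : ‖w‖ < 1 := mem_ball_zero_iff.mp hw
  obtain ⟨r, h1, h2⟩ := exists_between hw'
  have := (sigSer_differentiableOn k ((norm_nonneg w).trans h1.le) h2).differentiableAt
    (Metric.isOpen_ball.mem_nhds (mem_ball_zero_iff.mpr h1))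
  exact this.differentiableWithinAt

lemma sigSer_differentiableAt (k : ℕ) {q : ℂ} (hq : ‖q‖ < 1) :
    DifferentiableAt ℂ (sigSer k) q :=
  (sigSer_differentiableOn_ball k).differentiableAt
    (Metric.isOpen_ball.mem_nhds (mem_ball_zero_iff.mpr hq))

lemma sigSer_deriv_continuousAt (k : ℕ) : ContinuousAt (deriv (sigSer k)) 0 :=
  (((sigSer_differentiableOn_ball k).deriv Metric.isOpen_ball).differentiableAt
    (Metric.isOpen_ball.mem_nhds (by simp))).continuousAt

lemma qq_norm_lt (z : ℍ) : ‖qq z‖ < 1 := UpperHalfPlane.norm_exp_two_pi_I_lt_one z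

lemma qq_tendsto : Tendsto (fun z : ℍ => qq z) atImInfty (𝓝 0) := by
  have := UpperHalfPlane.qParam_tendsto_atImInfty (h := 1) one_pos
  simpa [Function.Periodic.qParam, qq] using this

lemma sigSer_tendsto (k : ℕ) : Tendsto (fun z : ℍ => sigSer k (qq z)) atImInfty (𝓝 0) := by
  have h := (sigSer_differentiableAt k (q := 0) (by simp)).continuousAt.tendsto
  rw [sigSer_zero] at h
  exact h.comp qq_tendsto

lemma sigSer_pnat (k : ℕ) (z : ℍ) : sigSer k (qq z) = ∑' n : ℕ+,
    (ArithmeticFunction.sigma k n : ℂ) * cexp (2 * Real.pi * Complex.I * z) ^ (n : ℕ) := by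
  rw [tsum_pnat_eq_tsum_succ (f := fun n : ℕ => (ArithmeticFunction.sigma k n : ℂ) *
    cexp (2 * Real.pi * Complex.I * z) ^ n)]
  simp only [sigSer, sigmaC_eq, qq]

lemma E2_eq (z : ℍ) : EisensteinSeries.E2 z = E2 z := by
  rw [EisensteinSeries.E2_eq_tsum_cexp, E2, ← sigSer, sigSer_pnat]

lemma bern4 : bernoulli 4 = -1/30 := by
  norm_num [bernoulli, bernoulli'_four]

lemma bern6 : bernoulli 6 = 1/42 := by
  have h5 : bernoulli' 5 = 0 := by
    rw [bernoulli'_def]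
    norm_num [Finset.sum_range_succ, Nat.choose_eq_factorial_div_factorial, Nat.factorial]
  rw [bernoulli, bernoulli'_def]
  norm_num [Finset.sum_range_succ, Nat.choose_eq_factorial_div_factorial, Nat.factorial, h5]

lemma E4_eq (z : ℍ) : ModularForm.E₄ z = E4 z := by
  have := EisensteinSeries.q_expansion_bernoulli (k := 4) (by norm_num) (by decide) z
  simp only [zpow_natCast] at this
  rw [this, E4, ← sigSer, sigSer_pnat, bern4]
  norm_num

lemma E6_eq (z : ℍ) : ModularForm.E₆ z = E6 z := by
  have := EisensteinSeries.q_expansion_bernoulli (k := 6) (by norm_num) (by decide) z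
  simp only [zpow_natCast] at this
  rw [this, E6, ← sigSer, sigSer_pnat, bern6]
  norm_num

lemma E6_hasDerivAt (z : ℍ) : HasDerivAt E6
    (-504 * (deriv (sigSer 5) (qq z) * (qq z * (2 * Real.pi * Complex.I)))) z := by
  have h1 : HasDerivAt qq (qq z * (2 * Real.pi * Complex.I)) z := by
    unfold qq
    have := ((hasDerivAt_id (z : ℂ)).const_mul (2 * Real.pi * Complex.I)).cexp
    simpa using this
  have h2 := (sigSer_differentiableAt 5 (qq_norm_lt z)).hasDerivAt.comp (z : ℂ) h1
  have h3 := (h2.const_mul 504).const_sub 1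
  convert! h3 using 1
  ring

lemma deriv_E6_comp (z : ℍ) :
    deriv ((ModularForm.E₆ : ℍ → ℂ) ∘ ofComplex) z = deriv E6 z := by
  apply Filter.EventuallyEq.deriv_eq
  filter_upwards [UpperHalfPlane.isOpen_upperHalfPlaneSet.mem_nhds z.im_pos] with w hw
  simp only [Function.comp_apply]
  rw [E6_eq, UpperHalfPlane.ofComplex_apply_of_im_pos hw]

/-- The weight 8 combination, which will turn out to vanish. -/
noncomputable def ramF : ℍ → ℂ :=
  Derivative.serreDerivative ((6 : ℤ) : ℂ) ModularForm.E₆ +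
    (1 / 2 : ℂ) • ((ModularForm.E₄ : ℍ → ℂ) * ModularForm.E₄)

lemma ramF_apply (z : ℍ) : ramF z =
    (2 * Real.pi * Complex.I)⁻¹ * deriv E6 z - 1 / 2 * (E2 z * E6 z - E4 z ^ 2) := by
  simp only [ramF, Pi.add_apply, Derivative.serreDerivative_apply, Pi.smul_apply, Pi.mul_apply,
    Derivative.normalizedDerivOfComplex, deriv_E6_comp, E2_eq, E4_eq, E6_eq, smul_eq_mul]
  push_cast
  ring

lemma ramF_slash (γ : SL(2, ℤ)) : ramF ∣[(8 : ℤ)] γ = ramF := by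
  have h6 : (ModularForm.E₆ : ℍ → ℂ) ∣[(6 : ℤ)] γ = ModularForm.E₆ :=
    ModularForm.E₆.slash_action_eq' _ ⟨γ, rfl⟩
  have h4 : (ModularForm.E₄ : ℍ → ℂ) ∣[(4 : ℤ)] γ = ModularForm.E₄ :=
    ModularForm.E₄.slash_action_eq' _ ⟨γ, rfl⟩
  have hS := Derivative.serreDerivative_slash_invariant (k := 6) ModularForm.E₆.holo' h6
  have hM := ModularForm.mul_slash_SL2 4 4 γ ModularForm.E₄ ModularForm.E₄
  rw [h4] at hM
  norm_num only at hS hM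
  rw [ramF, SlashAction.add_slash, ModularForm.SL_smul_slash, hM]
  congr 1

lemma ramF_mdiff : MDiff ramF := by
  refine (Derivative.serreDerivative_mdifferentiable _ ModularForm.E₆.holo').add ?_
  exact (ModularForm.E₄.holo'.mul ModularForm.E₄.holo').const_smul _

lemma ramF_zero : UpperHalfPlane.IsZeroAtImInfty ramF := by
  have h2 : Tendsto (fun z : ℍ => E2 z) atImInfty (𝓝 1) := by
    simpa [E2, sigSer] using ((sigSer_tendsto 1).const_mul 24).const_sub 1
  have h4 : Tendsto (fun z : ℍ => E4 z) atImInfty (𝓝 1) := by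
    simpa [E4, sigSer] using ((sigSer_tendsto 3).const_mul 240).const_add 1
  have h6 : Tendsto (fun z : ℍ => E6 z) atImInfty (𝓝 1) := by
    simpa [E6, sigSer] using ((sigSer_tendsto 5).const_mul 504).const_sub 1
  have hd : Tendsto (fun z : ℍ => deriv E6 z) atImInfty (𝓝 0) := by
    have := (((sigSer_deriv_continuousAt 5).tendsto.comp qq_tendsto).mul
      (qq_tendsto.mul_const (2 * Real.pi * Complex.I))).const_mul (-504)
    simp only [zero_mul, mul_zero] at this
    exact this.congr fun z => (E6_hasDerivAt z).deriv.symm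
  have := (hd.const_mul (2 * Real.pi * Complex.I)⁻¹).sub
    (((h2.mul h6).sub (h4.pow 2)).const_mul (1 / 2))
  rw [UpperHalfPlane.IsZeroAtImInfty, Filter.ZeroAtFilter]
  simp only [one_pow, mul_one, sub_self, mul_zero] at this
  exact this.congr fun z => (ramF_apply z).symm

/-- `ramF` as a cusp form. -/
noncomputable def ramCusp : CuspForm 𝒮ℒ 8 where
  toFun := ramF
  slash_action_eq' := fun _ ⟨γ, hγ⟩ ↦ hγ ▸ ramF_slash γ
  holo' := ramF_mdiff
  zero_at_cusps' {c} hc := by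
    rw [Subgroup.IsArithmetic.isCusp_iff_isCusp_SL2Z] at hc
    rw [OnePoint.isZeroAt_iff_forall_SL2Z hc]
    intro γ _
    rw [ramF_slash]
    exact ramF_zero

lemma ramF_eq_zero (z : ℍ) : ramF z = 0 := by
  have h := ModularForm.discriminant_mul_discriminantEquiv_apply ramCusp z
  rw [ModularFormClass.levelOne_neg_weight_eq_zero (k := 8 - 12) (by norm_num)
    (CuspForm.discriminantEquiv ramCusp)] at h
  have h' : ramCusp z = 0 := by simpa using h.symm
  exact h'

end Helpers

theorem ramanujan_E6 (τ : ℂ) (hτ : 0 < τ.im) :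
    deriv E6 τ = (Real.pi : ℂ) * Complex.I * (E2 τ * E6 τ - E4 τ ^ 2) := by
  have h := ramF_eq_zero ⟨τ, hτ⟩
  rw [ramF_apply] at h
  change (2 * Real.pi * Complex.I)⁻¹ * deriv E6 τ - 1 / 2 * (E2 τ * E6 τ - E4 τ ^ 2) = 0 at h
  have hpi : (Real.pi : ℂ) ≠ 0 := by exact_mod_cast Real.pi_ne_zero
  have hI := Complex.I_ne_zero
  field_simp at h
  linear_combination h
end

section
/- Under the transformation τ ↦ (aτ+b)/(cτ+d) for (a b; c d) ∈ SL(2,ℤ), the quasi-periods transform by (η₂, η₁)((aτ+b)/(cτ+d))ᵀ = (cτ+d)·(a b; c d)·(η₂, η₁)(τ)ᵀ; i.e. η₂(γτ) = (cτ+d)(aη₂(τ)+bη₁(τ)) and η₁(γτ) = (cτ+d)(cη₂(τ)+dη₁(τ)). -/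
open Complex Filter Asymptotics Set

theorem E2_eq_mathlib (z : UpperHalfPlane) : E2 (z : ℂ) = EisensteinSeries.E2 z := by
  rw [EisensteinSeries.E2_eq_tsum_cexp, E2]
  congr 2
  rw [tsum_pnat_eq_tsum_succ
    (f := fun n : ℕ => ((ArithmeticFunction.sigma 1 n : ℕ) : ℂ) *
      cexp (2 * Real.pi * I * z) ^ n)]
  refine tsum_congr fun n => ?_
  simp [sigmaC, qq, ArithmeticFunction.sigma_apply]

theorem E2_transform (a b c d : ℤ) (h : a * d - b * c = 1) (τ : ℂ) (hτ : 0 < τ.im)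
    (hne : (c : ℂ) * τ + d ≠ 0) :
    (Real.pi : ℂ) ^ 2 * E2 (((a : ℂ) * τ + b) / ((c : ℂ) * τ + d)) =
      (Real.pi : ℂ) ^ 2 * ((c : ℂ) * τ + d) ^ 2 * E2 τ
        - 6 * Real.pi * I * c * ((c : ℂ) * τ + d) := by
  let γ : Matrix.SpecialLinearGroup (Fin 2) ℤ :=
    ⟨!![a, b; c, d], by rw [Matrix.det_fin_two_of]; exact h⟩
  let z : UpperHalfPlane := ⟨τ, hτ⟩
  have hd : UpperHalfPlane.denom γ z = (c : ℂ) * τ + d := by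
    rw [ModularGroup.denom_apply]
    rfl
  have hs : ((γ • z : UpperHalfPlane) : ℂ) = ((a : ℂ) * τ + b) / ((c : ℂ) * τ + d) := by
    rw [UpperHalfPlane.coe_specialLinearGroup_apply]
    simp [γ, z]
  have key := congrFun (EisensteinSeries.E2_slash_action γ) z
  have hc : γ 1 0 = c := rfl
  simp only [ModularForm.SL_slash_apply, Pi.sub_apply, Pi.smul_apply, smul_eq_mul,
    EisensteinSeries.D2, hd, hc, riemannZeta_two, ← E2_eq_mathlib, hs] at key
  have hz : (z : ℂ) = τ := rfl
  rw [hz] at key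
  have hpi : (Real.pi : ℂ) ≠ 0 := by exact_mod_cast Real.pi_ne_zero
  rw [zpow_neg, zpow_ofNat] at key
  have k2 := congrArg (fun x => (Real.pi : ℂ) ^ 2 * ((c : ℂ) * τ + d) ^ 2 * x) key
  generalize E2 (((a : ℂ) * τ + b) / ((c : ℂ) * τ + d)) = X at *
  field_simp at k2 ⊢
  linear_combination k2

theorem quasiperiod_transformation (a b c d : ℤ) (h : a * d - b * c = 1)
    (τ : ℂ) (hτ : 0 < τ.im) :
    eta2 (((a : ℂ) * τ + b) / ((c : ℂ) * τ + d)) =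
      ((c : ℂ) * τ + d) * ((a : ℂ) * eta2 τ + (b : ℂ) * eta1 τ) ∧
    eta1 (((a : ℂ) * τ + b) / ((c : ℂ) * τ + d)) =
      ((c : ℂ) * τ + d) * ((c : ℂ) * eta2 τ + (d : ℂ) * eta1 τ) := by
  have hne : (c : ℂ) * τ + d ≠ 0 := by
    intro h0
    have him := congrArg Complex.im h0
    have hre := congrArg Complex.re h0
    simp at him hre
    rcases him with hc | hc
    · subst hc
      simp at hre
      subst hre
      simp at h
    · exact hτ.ne' hc
  have key := E2_transform a b c d h τ hτ hne
  have hC : (a : ℂ) * d - b * c = 1 := by exact_mod_cast h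
  have h1 : eta1 (((a : ℂ) * τ + b) / ((c : ℂ) * τ + d)) =
      ((c : ℂ) * τ + d) * ((c : ℂ) * eta2 τ + (d : ℂ) * eta1 τ) := by
    simp only [eta2, eta1]
    linear_combination key / 3
  refine ⟨?_, h1⟩
  rw [eta2, h1]
  have : ((a : ℂ) * τ + b) / ((c : ℂ) * τ + d) *
      (((c : ℂ) * τ + d) * ((c : ℂ) * eta2 τ + (d : ℂ) * eta1 τ)) =
      ((a : ℂ) * τ + b) * ((c : ℂ) * eta2 τ + (d : ℂ) * eta1 τ) := by
    rw [← mul_assoc, div_mul_cancel₀ _ hne]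
  rw [this]
  simp only [eta2]
  linear_combination (2 * (Real.pi : ℂ) * Complex.I) * hC
end
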